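/- arXiv:2501.06415 — 2 statements merged into one kernel-verified Lean document; each statement's English description precedes it below -/
import Mathlib

section
/- Let J ⊆ I_H be a homogeneous (graded) ideal of S = k[X₁,...,Xₙ] (with deg Xᵢ = aᵢ). If dim_k S/(J + (X₁)) = a₁, then J = I_H. -/
open MvPolynomial

/-- The image of a monomial under `X i ↦ X ^ a i`. -/
lemma aeval_X_pow_monomial {k σ : Type*} [Field k] (a : σ → ℕ) (m : σ →₀ ℕ) (c : k) :
    aeval (fun i => (Polynomial.X : Polynomial k) ^ a i) (monomial m c) =
      Polynomial.monomial (Finsupp.weight a m) c := by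
  rw [aeval_monomial, Finsupp.weight_apply, ← Polynomial.C_mul_X_pow_eq_monomial]
  simp only [Finsupp.prod, Finsupp.sum, ← pow_mul, Finset.prod_pow_eq_pow_sum, smul_eq_mul,
    mul_comm, Polynomial.algebraMap_eq]

/-- The image of `X i ↦ X ^ a i` is supported on the monoid generated by the `a i`. -/
lemma coeff_aeval_X_pow_eq_zero {k σ : Type*} [Field k] (a : σ → ℕ) {s : ℕ}
    (hs : s ∉ AddMonoidHom.mrange (Finsupp.weight (R := ℕ) a)) (p : MvPolynomial σ k) :
    (aeval (fun i => (Polynomial.X : Polynomial k) ^ a i) p).coeff s = 0 := by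
  induction p using MvPolynomial.induction_on' with
  | monomial m c =>
    rw [aeval_X_pow_monomial, Polynomial.coeff_monomial, if_neg]
    exact fun h => hs ⟨m, h⟩
  | add p q hp hq => rw [map_add, Polynomial.coeff_add, hp, hq, add_zero]

/-- If the `a i` are coprime, they generate a submonoid of `ℕ` meeting every residue class. -/
lemma exists_mem_mrange_weight_mod {σ : Type*} [Fintype σ] (a : σ → ℕ)
    (hgcd : Finset.univ.gcd a = 1) {b r : ℕ} (hr : r < b) :
    ∃ x, x ∈ AddMonoidHom.mrange (Finsupp.weight (R := ℕ) a) ∧ x % b = r := by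
  obtain ⟨N, hN⟩ := Nat.exists_mem_closure_of_ge (Set.range a)
  have hone : Nat.setGcd (Set.range a) = 1 :=
    Nat.dvd_one.mp <| hgcd ▸ Finset.dvd_gcd fun i _ => Nat.setGcd_dvd_of_mem ⟨i, rfl⟩
  have hle : AddSubmonoid.closure (Set.range a) ≤
      AddMonoidHom.mrange (Finsupp.weight (R := ℕ) a) := by
    rw [AddSubmonoid.closure_le]
    rintro _ ⟨i, rfl⟩
    exact ⟨Finsupp.single i 1, by simp [Finsupp.weight_apply]⟩
  refine ⟨r + b * N, hle (hN _ ?_ (hone ▸ one_dvd _)), ?_⟩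
  · have : N ≤ b * N := Nat.le_mul_of_pos_left _ (by omega)
    omega
  · rw [Nat.add_mul_mod_self_left, Nat.mod_eq_of_lt hr]

/-- The Apéry elements: the least elements of the residue classes modulo `b`. -/
lemma exists_apery {σ : Type*} [Fintype σ] (a : σ → ℕ)
    (hgcd : Finset.univ.gcd a = 1) (b : ℕ) :
    ∃ w : Fin b → ℕ, Function.Injective w ∧
      (∀ r, w r ∈ AddMonoidHom.mrange (Finsupp.weight (R := ℕ) a)) ∧
      ∀ r x, x + b = w r → x ∉ AddMonoidHom.mrange (Finsupp.weight (R := ℕ) a) := by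
  classical
  have h (r : Fin b) := exists_mem_mrange_weight_mod a hgcd r.2
  refine ⟨fun r => Nat.find (h r), fun r s hrs => ?_, fun r => (Nat.find_spec (h r)).1,
    fun r x hx hmem => ?_⟩
  · have hr := (Nat.find_spec (h r)).2
    have hs := (Nat.find_spec (h s)).2
    dsimp only at hrs
    rw [hrs] at hr
    exact Fin.ext (hr.symm.trans hs)
  · have hr := (Nat.find_spec (h r)).2
    dsimp only at hx
    rw [← hx, Nat.add_mod_right] at hr
    have := Nat.find_min' (h r) ⟨hmem, hr⟩
    have := r.2
    omega

/-- The components of `X i * p` are obtained from those of `p` by multiplication by `X i`. -/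
lemma weightedHomogeneousComponent_X_mul {k σ : Type*} [Field k] (a : σ → ℕ) (i : σ) (d : ℕ)
    (p : MvPolynomial σ k) :
    weightedHomogeneousComponent a d (X i * p) =
      if a i ≤ d then X i * weightedHomogeneousComponent a (d - a i) p else 0 := by
  classical
  induction p using MvPolynomial.induction_on' with
  | monomial m c =>
    have hm := isWeightedHomogeneous_monomial a m c rfl
    rw [weightedHomogeneousComponent_of_mem ((isWeightedHomogeneous_X k a i).mul hm),
      weightedHomogeneousComponent_of_mem hm]
    split_ifs <;> first | omega | simp
  | add p q hp hq =>
    rw [mul_add, map_add, hp, hq, map_add]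
    split_ifs <;> ring

/-- If `J` has the expected colength modulo `X i`, then it contains the kernel of
`X j ↦ X ^ a j` modulo `X i`. -/
lemma ker_aeval_le_sup_span_X {k σ : Type*} [Field k] [Fintype σ] (a : σ → ℕ) (i : σ)
    (hi : 0 < a i) (hgcd : Finset.univ.gcd a = 1) (J : Ideal (MvPolynomial σ k))
    (hJI : J ≤ RingHom.ker (aeval fun j : σ => (Polynomial.X : Polynomial k) ^ a j).toRingHom)
    (hdim : Module.finrank k
      (MvPolynomial σ k ⧸ (J ⊔ Ideal.span {(X i : MvPolynomial σ k)})) = a i) :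
    RingHom.ker (aeval fun j : σ => (Polynomial.X : Polynomial k) ^ a j).toRingHom ≤
      J ⊔ Ideal.span {X i} := by
  classical
  obtain ⟨w, hinj, hmem, hmin⟩ := exists_apery a hgcd (a i)
  set K := J ⊔ Ideal.span {(X i : MvPolynomial σ k)}
  let L : MvPolynomial σ k →ₗ[k] (Fin (a i) → k) :=
    LinearMap.pi fun r => Polynomial.lcoeff k (w r) ∘ₗ
      (aeval fun j : σ => (Polynomial.X : Polynomial k) ^ a j).toLinearMap
  have hL (p r) : L p r = (aeval (fun j => (Polynomial.X : Polynomial k) ^ a j) p).coeff (w r) :=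
    rfl
  have hLK : K.restrictScalars k ≤ LinearMap.ker L := by
    intro f hf
    obtain ⟨j, hj, y, hy, rfl⟩ := Submodule.mem_sup.mp hf
    obtain ⟨g, rfl⟩ := Ideal.mem_span_singleton'.mp hy
    have hj0 : aeval (fun j => (Polynomial.X : Polynomial k) ^ a j) j = 0 := hJI hj
    ext r
    rw [hL, map_add, hj0, zero_add, map_mul, aeval_X, Polynomial.coeff_mul_X_pow', Pi.zero_apply]
    split_ifs with hle
    · exact coeff_aeval_X_pow_eq_zero a (hmin r _ (Nat.sub_add_cancel hle)) g
    · rfl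
  let Lbar : (MvPolynomial σ k ⧸ K) →ₗ[k] (Fin (a i) → k) :=
    (K.restrictScalars k).liftQ L hLK
  have hbar (p) : Lbar (Ideal.Quotient.mk K p) = L p := rfl
  have hsurj : Function.Surjective Lbar := by
    choose m hm using hmem
    intro v
    refine ⟨Ideal.Quotient.mk K (∑ r, monomial (m r) (v r)), ?_⟩
    ext s
    rw [hbar, map_sum, Finset.sum_apply, Finset.sum_eq_single s]
    · rw [hL, aeval_X_pow_monomial, hm, Polynomial.coeff_monomial, if_pos rfl]
    · intro r _ hrs
      rw [hL, aeval_X_pow_monomial, hm, Polynomial.coeff_monomial, if_neg (hinj.ne hrs)]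
    · simp
  have : FiniteDimensional k (MvPolynomial σ k ⧸ K) :=
    Module.finite_of_finrank_pos (hdim ▸ hi)
  have hLinj : Function.Injective Lbar :=
    (LinearMap.injective_iff_surjective_of_finrank_eq_finrank (by simp [hdim])).mpr hsurj
  intro f hf
  have hf0 : aeval (fun j => (Polynomial.X : Polynomial k) ^ a j) f = 0 := hf
  refine Ideal.Quotient.eq_zero_iff_mem.mp (hLinj ?_)
  rw [hbar, map_zero]
  ext r
  rw [hL, hf0, Polynomial.coeff_zero, Pi.zero_apply]

theorem stmt6 (k : Type*) [Field k] (n : ℕ) [NeZero n] (a : Fin n → ℕ)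
    (hpos : ∀ i, 0 < a i) (hgcd : Finset.univ.gcd a = 1)
    (hmult : ∀ i, a 0 ≤ a i)
    (J : Ideal (MvPolynomial (Fin n) k))
    (hJI : J ≤ RingHom.ker (aeval fun i : Fin n =>
      (Polynomial.X : Polynomial k) ^ a i).toRingHom)
    (hhom : ∀ p ∈ J, ∀ d : ℕ, weightedHomogeneousComponent a d p ∈ J)
    (hdim : Module.finrank k
      (MvPolynomial (Fin n) k ⧸ (J ⊔ Ideal.span {(X 0 : MvPolynomial (Fin n) k)})) = a 0) :
    J = RingHom.ker (aeval fun i : Fin n =>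
      (Polynomial.X : Polynomial k) ^ a i).toRingHom := by
  have hle := ker_aeval_le_sup_span_X a 0 (hpos 0) hgcd J hJI hdim
  refine le_antisymm hJI fun f hf => ?_
  have key : ∀ d : ℕ, ∀ f ∈ RingHom.ker (aeval fun i : Fin n =>
      (Polynomial.X : Polynomial k) ^ a i).toRingHom,
      weightedHomogeneousComponent a d f ∈ J := by
    intro d
    induction d using Nat.strong_induction_on with
    | _ d ih =>
      intro f hf
      obtain ⟨j, hj, y, hy, rfl⟩ := Submodule.mem_sup.mp (hle hf)
      obtain ⟨g, rfl⟩ := Ideal.mem_span_singleton.mp hy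
      rw [map_add, weightedHomogeneousComponent_X_mul]
      refine J.add_mem (hhom j hj d) ?_
      split_ifs with hd
      · refine J.mul_mem_left _ (ih _ (Nat.sub_lt ((hpos 0).trans_le hd) (hpos 0)) g ?_)
        have hX := (Ideal.add_mem_iff_right _ (hJI hj)).mp hf
        refine ((RingHom.ker_isPrime _).mem_or_mem hX).resolve_left fun h => ?_
        have h0 : aeval (fun i => (Polynomial.X : Polynomial k) ^ a i) (X (0 : Fin n)) = 0 := h
        rw [aeval_X] at h0
        exact pow_ne_zero _ Polynomial.X_ne_zero h0
      · exact J.zero_mem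
  rw [← sum_weightedHomogeneousComponent a f]
  exact finsum_induction (· ∈ J) J.zero_mem (fun _ _ => J.add_mem) fun d => key d f hf
end

section
/- Let H = ⟨a₁,...,aₙ⟩ be a numerical semigroup with multiplicity a₁ and embedding dimension n, and set ℓ = a₁ - n + 1. The Artinian local ring k[H]/(t^{a₁}) is stretched if and only if the Apéry set Ap(H, a₁) has the form {0, a₂, ..., aₙ} if ℓ = 1, {0, a₂, ..., aₙ} ∪ {a_λ + a_μ} for some 2 ≤ λ ≤ μ ≤ n if ℓ = 2, and {0, a₂, ..., aₙ} ∪ {2a_λ, 3a_λ, ..., ℓa_λ} for some 2 ≤ λ ≤ n if ℓ ≥ 3. -/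
/-- A numerical semigroup, viewed as a set of integers: it contains 0, is closed under
addition, consists of nonnegative integers, and has finite complement in ℕ. -/
def IsNumericalSemigroup (H : Set ℤ) : Prop :=
  0 ∈ H ∧ (∀ x ∈ H, ∀ y ∈ H, x + y ∈ H) ∧ (∀ x ∈ H, 0 ≤ x) ∧
    {z : ℤ | 0 ≤ z ∧ z ∉ H}.Finite

/-- The set of pseudo-Frobenius numbers of `H`. -/
def PF (H : Set ℤ) : Set ℤ :=
  {f : ℤ | f ∉ H ∧ ∀ s ∈ H, s ≠ 0 → f + s ∈ H}

/-- The Apéry set of `H` with respect to `h`. -/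
def Ap (H : Set ℤ) (h : ℤ) : Set ℤ := {x ∈ H | x - h ∉ H}

/-- The set of minimal generators of `H`: nonzero elements that are not a sum of two
nonzero elements of `H`. -/
def MinGens (H : Set ℤ) : Set ℤ :=
  {x ∈ H | x ≠ 0 ∧ ¬ ∃ y ∈ H, ∃ z ∈ H, y ≠ 0 ∧ z ≠ 0 ∧ y + z = x}
open Polynomial

/-- An Artinian local ring is stretched if the square of its maximal ideal is zero or
principal. For a commutative ring we ask this for every maximal ideal. -/
def Stretched (A : Type*) [CommRing A] : Prop :=
  ∀ I : Ideal A, I.IsMaximal → (I ^ 2 : Ideal A).IsPrincipal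

/-- The numerical semigroup ring k[H] ⊆ k[t], for H generated by the aᵢ. -/
noncomputable def NSRing (k : Type*) [Field k] {n : ℕ} (a : Fin n → ℕ) :
    Subalgebra k (Polynomial k) :=
  Algebra.adjoin k (Set.range fun i => (X : Polynomial k) ^ a i)

/-- The element t^{a₀} of k[H]. -/
noncomputable def tMult (k : Type*) [Field k] {n : ℕ} [NeZero n] (a : Fin n → ℕ) :
    NSRing k a :=
  ⟨(X : Polynomial k) ^ a 0, Algebra.subset_adjoin ⟨0, rfl⟩⟩

section SemigroupRing

variable {k : Type*} [Field k] {n : ℕ} {a : Fin n → ℕ}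

/-- An exponent occurring in an element of `k[H]` lies in the semigroup. -/
theorem NSRing.mem_closure_of_coeff_ne_zero (f : NSRing k a) {e : ℕ}
    (he : (f : k[X]).coeff e ≠ 0) : e ∈ AddSubmonoid.closure (Set.range a) := by
  obtain ⟨f, hf⟩ := f
  simp only at he
  induction hf using Algebra.adjoin_induction generalizing e with
  | mem x hx =>
    obtain ⟨i, rfl⟩ := hx
    have : e = a i := by
      by_contra h
      simp [coeff_X_pow, h] at he
    exact this ▸ AddSubmonoid.subset_closure ⟨i, rfl⟩
  | algebraMap r =>
    have : e = 0 := by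
      by_contra h
      simp [coeff_C, h] at he
    exact this ▸ zero_mem _
  | add x y _ _ hx hy =>
    by_cases h : x.coeff e = 0
    · exact hy (by simpa [h] using he)
    · exact hx h
  | mul x y _ _ hx hy =>
    rw [coeff_mul] at he
    obtain ⟨p, hp, hne⟩ := Finset.exists_ne_zero_of_sum_ne_zero he
    rw [← Finset.HasAntidiagonal.mem_antidiagonal.mp hp]
    exact add_mem (hx (left_ne_zero_of_mul hne)) (hy (right_ne_zero_of_mul hne))

theorem X_pow_mem_NSRing {s : ℕ} (hs : s ∈ AddSubmonoid.closure (Set.range a)) :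
    (X : k[X]) ^ s ∈ NSRing k a := by
  induction hs using AddSubmonoid.closure_induction with
  | mem x hx =>
    obtain ⟨i, rfl⟩ := hx
    exact Algebra.subset_adjoin ⟨i, rfl⟩
  | zero => simp
  | add x y _ _ hx hy => rw [pow_add]; exact mul_mem hx hy

variable (k a) in
/-- The generator `t^{aᵢ}` of `k[H]`. -/
noncomputable def tGen (i : Fin n) : NSRing k a :=
  ⟨(X : k[X]) ^ a i, Algebra.subset_adjoin ⟨i, rfl⟩⟩

@[simp]
theorem coe_tGen (i : Fin n) : (tGen k a i : k[X]) = X ^ a i := rfl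

variable (k a) in
/-- The ideal of `k[H]` generated by the monomials `t^{aᵢ}`. -/
noncomputable def tIdeal : Ideal (NSRing k a) := Ideal.span (Set.range (tGen k a))

theorem tGen_mem_tIdeal (i : Fin n) : tGen k a i ∈ tIdeal k a := Ideal.subset_span ⟨i, rfl⟩

theorem exists_sub_algebraMap_mem_tIdeal (f : NSRing k a) :
    ∃ c : k, f - algebraMap k _ c ∈ tIdeal k a := by
  obtain ⟨f, hf⟩ := f
  induction hf using Algebra.adjoin_induction with
  | mem x hx =>
    obtain ⟨i, rfl⟩ := hx
    exact ⟨0, by rw [map_zero, sub_zero]; exact tGen_mem_tIdeal i⟩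
  | algebraMap r =>
    refine ⟨r, ?_⟩
    convert zero_mem (tIdeal k a)
    exact sub_self _
  | add x y hx hy h₁ h₂ =>
    obtain ⟨c, hc⟩ := h₁
    obtain ⟨d, hd⟩ := h₂
    refine ⟨c + d, ?_⟩
    convert add_mem hc hd using 1
    rw [map_add, ← add_sub_add_comm]
    rfl
  | mul x y hx hy h₁ h₂ =>
    obtain ⟨c, hc⟩ := h₁
    obtain ⟨d, hd⟩ := h₂
    refine ⟨c * d, ?_⟩
    convert add_mem (Ideal.mul_mem_right ⟨y, hy⟩ _ hc)
      (Ideal.mul_mem_left _ (algebraMap k _ c) hd) using 1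
    rw [map_mul, show (⟨x * y, mul_mem hx hy⟩ : NSRing k a) = ⟨x, hx⟩ * ⟨y, hy⟩ from rfl]
    ring

theorem tIdeal_sq :
    tIdeal k a ^ 2 =
      Ideal.span (Set.range fun p : Fin n × Fin n => tGen k a p.1 * tGen k a p.2) := by
  rw [sq, tIdeal, Ideal.span_mul_span', ← Set.image2_mul, Set.image2_range]

/-- Exponents occurring in an element of the square of the maximal ideal are sums of two
nonzero elements of the semigroup. -/
theorem exists_eq_add_of_mem_tIdeal_sq {f : NSRing k a} (hf : f ∈ tIdeal k a ^ 2) {e : ℕ}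
    (he : (f : k[X]).coeff e ≠ 0) :
    ∃ i j, ∃ s ∈ AddSubmonoid.closure (Set.range a), e = a i + a j + s := by
  rw [tIdeal_sq] at hf
  induction hf using Submodule.span_induction generalizing e with
  | mem x hx =>
    obtain ⟨⟨i, j⟩, rfl⟩ := hx
    refine ⟨i, j, 0, zero_mem _, ?_⟩
    by_contra h
    simp [← pow_add, coeff_X_pow] at he h
    exact h he
  | zero => simp at he
  | add x y _ _ hx hy =>
    by_cases h : (x : k[X]).coeff e = 0
    · exact hy (by simpa [h] using he)
    · exact hx h
  | smul r x _ hx =>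
    rw [smul_eq_mul, MulMemClass.coe_mul, coeff_mul] at he
    obtain ⟨p, hp, hne⟩ := Finset.exists_ne_zero_of_sum_ne_zero he
    obtain ⟨i, j, s, hs, h⟩ := hx (right_ne_zero_of_mul hne)
    refine ⟨i, j, p.1 + s,
      add_mem (NSRing.mem_closure_of_coeff_ne_zero _ (left_ne_zero_of_mul hne)) hs, ?_⟩
    rw [← Finset.HasAntidiagonal.mem_antidiagonal.mp hp, h]
    ring

variable [NeZero n]

@[simp]
theorem coe_tMult : (tMult k a : k[X]) = X ^ a 0 := rfl

theorem coeff_eq_zero_of_tMult_dvd {f : NSRing k a} (hf : tMult k a ∣ f) {w : ℕ}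
    (hw : ∀ s ∈ AddSubmonoid.closure (Set.range a), w ≠ a 0 + s) :
    (f : k[X]).coeff w = 0 := by
  obtain ⟨g, rfl⟩ := hf
  rw [mul_comm, MulMemClass.coe_mul, tMult, coeff_mul_X_pow']
  split_ifs with h
  · by_contra hne
    exact hw _ (NSRing.mem_closure_of_coeff_ne_zero g hne) (by omega)
  · rfl

variable {A : Type*} [CommRing A] {φ : NSRing k a →+* A}

theorem isMaximal_eq_map_tIdeal (hpos : ∀ i, 0 < a i) (hsurj : Function.Surjective φ)
    (hφ : φ (tMult k a) = 0) {I : Ideal A} (hI : I.IsMaximal) :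
    I = (tIdeal k a).map φ := by
  have hle : (tIdeal k a).map φ ≤ I := by
    rw [tIdeal, Ideal.map_span, Ideal.span_le]
    rintro _ ⟨_, ⟨i, rfl⟩, rfl⟩
    refine hI.isPrime.mem_of_pow_mem (a 0) ?_
    rw [← map_pow]
    have : tGen k a i ^ a 0 = tMult k a ^ a i := by
      ext1
      simp only [SubmonoidClass.coe_pow, coe_tGen, coe_tMult]
      rw [← pow_mul, ← pow_mul, mul_comm]
    rw [this, map_pow, hφ, zero_pow (hpos i).ne']
    exact zero_mem I
  refine le_antisymm (fun x hx => ?_) hle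
  obtain ⟨f, rfl⟩ := hsurj x
  obtain ⟨c, hc⟩ := exists_sub_algebraMap_mem_tIdeal f
  have hm := Ideal.mem_map_of_mem φ hc
  have hcI : φ (algebraMap k _ c) ∈ I := by
    have := sub_mem hx (hle hm)
    rwa [← map_sub, sub_sub_cancel] at this
  obtain rfl : c = 0 := by
    by_contra hc0
    exact hI.ne_top (Ideal.eq_top_of_isUnit_mem I hcI
      (((IsUnit.mk0 c hc0).map (algebraMap k (NSRing k a))).map _))
  simpa using hm

theorem stretched_of_forall_sub_mem (hpos : ∀ i, 0 < a i) (hsurj : Function.Surjective φ)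
    (hφ : φ (tMult k a) = 0) (i₀ j₀ : Fin n)
    (h : ∀ i j, (∃ s ∈ AddSubmonoid.closure (Set.range a), a i + a j = a 0 + s) ∨
      ∃ s ∈ AddSubmonoid.closure (Set.range a), a i + a j = a i₀ + a j₀ + s) :
    Stretched A := by
  intro I hI
  rw [isMaximal_eq_map_tIdeal hpos hsurj hφ hI, ← Ideal.map_pow, tIdeal_sq, Ideal.map_span]
  refine ⟨⟨φ (tGen k a i₀ * tGen k a j₀), le_antisymm ?_ ?_⟩⟩
  · rw [Ideal.span_le]
    rintro _ ⟨_, ⟨⟨i, j⟩, rfl⟩, rfl⟩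
    obtain ⟨s, hs, hij⟩ | ⟨s, hs, hij⟩ := h i j
    · change φ (tGen k a i * tGen k a j) ∈ Submodule.span A _
      have : tGen k a i * tGen k a j = tMult k a * ⟨X ^ s, X_pow_mem_NSRing hs⟩ := by
        ext1
        simp only [MulMemClass.coe_mul, coe_tGen, coe_tMult]
        rw [← pow_add, ← pow_add, hij]
      rw [this, map_mul φ (tMult k a), hφ, zero_mul]
      exact zero_mem _
    · refine Ideal.mem_span_singleton.mpr (map_dvd _ ⟨⟨X ^ s, X_pow_mem_NSRing hs⟩,
        Subtype.ext ?_⟩)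
      simp only [MulMemClass.coe_mul, coe_tGen]
      rw [← pow_add, ← pow_add, ← pow_add, hij]
  · exact Ideal.span_mono (by
      rintro _ rfl
      exact ⟨_, ⟨(i₀, j₀), rfl⟩, rfl⟩)

/-- If `k[H]/(t^{a₀})` is stretched, then the Apéry set has at most one element which is a sum of
two generators but not a sum of more of them. -/
theorem Stretched.eq_of_not_exists_add (hpos : ∀ i, 0 < a i)
    (hsurj : Function.Surjective φ) (hker : ∀ f, φ f = 0 ↔ tMult k a ∣ f) (hst : Stretched A)
    {i j i' j' : Fin n}
    (hw : ∀ s ∈ AddSubmonoid.closure (Set.range a), a i + a j ≠ a 0 + s)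
    (hw' : ∀ s ∈ AddSubmonoid.closure (Set.range a), a i' + a j' ≠ a 0 + s)
    (ho : ∀ p q, ∀ s ∈ AddSubmonoid.closure (Set.range a), s ≠ 0 → a i + a j ≠ a p + a q + s)
    (ho' : ∀ p q, ∀ s ∈ AddSubmonoid.closure (Set.range a), s ≠ 0 →
      a i' + a j' ≠ a p + a q + s) :
    a i + a j = a i' + a j' := by
  have hφ : φ (tMult k a) = 0 := (hker _).mpr dvd_rfl
  have : Nontrivial A := by
    rw [← not_subsingleton_iff_nontrivial]
    intro hsub
    have h := coeff_eq_zero_of_tMult_dvd (k := k) (a := a) (f := 1)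
      ((hker 1).mp (Subsingleton.elim _ _)) (w := 0) (fun s _ h => by have := hpos 0; omega)
    simp at h
  obtain ⟨I, hI⟩ := Ideal.exists_maximal A
  obtain ⟨⟨F, hF⟩⟩ := hst I hI
  rw [isMaximal_eq_map_tIdeal hpos hsurj hφ hI, ← Ideal.map_pow] at hF
  obtain ⟨f, hf, rfl⟩ := (Ideal.mem_map_iff_of_surjective _ hsurj).mp
    (hF ▸ Submodule.mem_span_singleton_self F)
  have hex : ∀ p q : Fin n, ∃ g : NSRing k a, ∀ w,
      (∀ s ∈ AddSubmonoid.closure (Set.range a), w ≠ a 0 + s) →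
      (∀ p q, ∀ s ∈ AddSubmonoid.closure (Set.range a), s ≠ 0 → w ≠ a p + a q + s) →
      (if w = a p + a q then (1 : k) else 0) = (g : k[X]).coeff 0 * (f : k[X]).coeff w := by
    intro p q
    have hmem : φ (tGen k a p * tGen k a q) ∈
        (tIdeal k a ^ 2).map φ := by
      rw [sq]
      exact Ideal.mem_map_of_mem _ (Ideal.mul_mem_mul (tGen_mem_tIdeal p) (tGen_mem_tIdeal q))
    rw [hF] at hmem
    obtain ⟨g, hg⟩ := Ideal.mem_span_singleton'.mp hmem
    obtain ⟨g, rfl⟩ := hsurj g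
    rw [← map_mul, ← sub_eq_zero, ← map_sub, hker] at hg
    refine ⟨g, fun w hw ho => ?_⟩
    have hc := coeff_eq_zero_of_tMult_dvd hg hw
    rw [AddSubgroupClass.coe_sub, coeff_sub, sub_eq_zero] at hc
    have h1 : ((tGen k a p * tGen k a q : NSRing k a) : k[X]).coeff w =
        if w = a p + a q then (1 : k) else 0 := by
      simp only [MulMemClass.coe_mul, coe_tGen]
      rw [← pow_add, coeff_X_pow]
    rw [← h1, ← hc, MulMemClass.coe_mul, coeff_mul]
    refine Finset.sum_eq_single (0, w) (fun b hb hne => ?_) (by simp)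
    by_contra hmul
    obtain ⟨i, j, s, hs, h⟩ := exists_eq_add_of_mem_tIdeal_sq hf (right_ne_zero_of_mul hmul)
    have hb' := Finset.HasAntidiagonal.mem_antidiagonal.mp hb
    refine ho i j (b.1 + s)
      (add_mem (NSRing.mem_closure_of_coeff_ne_zero _ (left_ne_zero_of_mul hmul)) hs)
      (fun h0 => hne ?_) (by omega)
    ext <;> simp <;> omega
  obtain ⟨g, hg⟩ := hex i j
  obtain ⟨g', hg'⟩ := hex i' j'
  by_contra hne
  have e1 := hg _ hw ho
  have e2 := hg _ hw' ho'
  have e3 := hg' _ hw' ho'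
  rw [if_pos rfl] at e1 e3
  rw [if_neg (Ne.symm hne)] at e2
  rcases mul_eq_zero.mp e2.symm with h | h
  · simp [h] at e1
  · simp [h] at e3

end SemigroupRing

section Apery

theorem natCast_mem_closure_iff {n : ℕ} {a : Fin n → ℕ} {s : ℕ} :
    (s : ℤ) ∈ AddSubmonoid.closure (Set.range fun i => (a i : ℤ)) ↔
      s ∈ AddSubmonoid.closure (Set.range a) := by
  have : AddSubmonoid.closure (Set.range fun i => (a i : ℤ)) =
      (AddSubmonoid.closure (Set.range a)).map (Nat.castAddMonoidHom ℤ) := by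
    rw [AddMonoidHom.map_mclosure, ← Set.range_comp]
    rfl
  rw [this, AddSubmonoid.mem_map]
  simp

theorem nonneg_of_mem_closure {n : ℕ} {a : Fin n → ℕ} {x : ℤ}
    (hx : x ∈ AddSubmonoid.closure (Set.range fun i => (a i : ℤ))) : 0 ≤ x := by
  induction hx using AddSubmonoid.closure_induction with
  | mem x hx =>
    obtain ⟨i, rfl⟩ := hx
    positivity
  | zero => rfl
  | add x y _ _ hx hy => exact add_nonneg hx hy

/-- A nonzero element of a submonoid generated by `S` is the sum of an element of `S` and an element
of the submonoid. -/
theorem AddSubmonoid.exists_eq_add_of_mem_closure {M : Type*} [AddCommMonoid M] {S : Set M} {x : M}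
    (hx : x ∈ AddSubmonoid.closure S) (h0 : x ≠ 0) :
    ∃ g ∈ S, ∃ y ∈ AddSubmonoid.closure S, x = g + y := by
  induction hx using AddSubmonoid.closure_induction with
  | mem x hx => exact ⟨x, hx, 0, zero_mem _, (add_zero x).symm⟩
  | zero => exact absurd rfl h0
  | add x y hx hy ihx ihy =>
    by_cases hx0 : x = 0
    · subst hx0
      rw [zero_add] at h0 ⊢
      exact ihy h0
    · obtain ⟨g, hg, z, hz, rfl⟩ := ihx hx0
      exact ⟨g, hg, z + y, add_mem hz hy, add_assoc g z y⟩

variable {M : AddSubmonoid ℤ}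

theorem mem_Ap_of_add_mem_Ap {m x y : ℤ} (hx : x ∈ M) (hy : y ∈ M) (h : x + y ∈ Ap M m) :
    x ∈ Ap M m :=
  ⟨hx, fun hxm => h.2 (by
    have := M.add_mem hxm hy
    rwa [sub_add_eq_add_sub] at this)⟩

/-- The Apéry set with respect to `m` has `m` elements. -/
theorem ncard_Ap (hnn : ∀ x ∈ M, 0 ≤ x) {m : ℕ} (hm : 0 < m) (hmM : (m : ℤ) ∈ M)
    (hfin : {z : ℤ | 0 ≤ z ∧ z ∉ (M : Set ℤ)}.Finite) : (Ap M m).ncard = m := by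
  have : NeZero m := ⟨hm.ne'⟩
  have key : ∀ x ∈ Ap M m, ∀ y ∈ Ap M m, (x : ZMod m) = y → ¬ x < y := by
    intro x hx y hy hxy hlt
    obtain ⟨c, hc⟩ := (ZMod.intCast_eq_intCast_iff_dvd_sub x y m).mp hxy
    have hm' : (0 : ℤ) < m := by exact_mod_cast hm
    have hc1 : 0 < c := by
      by_contra h
      nlinarith
    refine hy.2 ?_
    have h := M.add_mem hx.1 (M.nsmul_mem hmM (c - 1).toNat)
    rw [nsmul_eq_mul, show (((c - 1).toNat : ℕ) : ℤ) = c - 1 by omega] at h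
    rw [show y - m = x + (c - 1) * m by linear_combination hc]
    exact h
  have hinj : Set.InjOn (fun x : ℤ => (x : ZMod m)) (Ap M m) := fun x hx y hy hxy =>
    le_antisymm (not_lt.mp (key y hy x hx hxy.symm)) (not_lt.mp (key x hx y hy hxy))
  have hsurj : (fun x : ℤ => (x : ZMod m)) '' Ap M m = Set.univ := by
    refine Set.eq_univ_of_forall fun r => ?_
    have hex : ∃ t : ℕ, (r.val : ℤ) + m * t ∈ M := by
      by_contra! h
      refine Set.infinite_range_of_injective (f := fun t : ℕ => (r.val : ℤ) + m * t) ?_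
        (hfin.subset ?_)
      · intro t u htu
        simpa [hm.ne'] using htu
      · rintro _ ⟨t, rfl⟩
        exact ⟨by positivity, h t⟩
    classical
    refine ⟨(r.val : ℤ) + m * (Nat.find hex : ℕ), ⟨Nat.find_spec hex, fun h => ?_⟩, by simp⟩
    rcases Nat.eq_zero_or_pos (Nat.find hex) with h0 | h0
    · have h1 := hnn _ h
      have h2 := r.val_lt
      rw [h0] at h1
      push_cast at h1
      omega
    · refine Nat.find_min hex (Nat.sub_one_lt h0.ne') ?_
      rw [show (r.val : ℤ) + m * ((Nat.find hex - 1 : ℕ) : ℤ) =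
        r.val + m * (Nat.find hex : ℕ) - m by push_cast [Nat.cast_sub h0]; ring]
      exact h
  rw [← hinj.ncard_image, hsurj, Set.ncard_univ, Nat.card_zmod]

/-- The elements of the Apéry set which are neither zero nor minimal generators. -/
def decomposableAp (H : Set ℤ) (m : ℤ) : Set ℤ := Ap H m \ insert 0 (MinGens H)

theorem exists_add_eq_of_mem_decomposableAp {m w : ℤ} (hw : w ∈ decomposableAp M m) :
    ∃ x ∈ M, ∃ y ∈ M, x ≠ 0 ∧ y ≠ 0 ∧ x + y = w := by
  by_contra h
  refine hw.2 (or_iff_not_imp_left.mpr fun h0 => ⟨hw.1.1, h0, h⟩)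

theorem add_mem_decomposableAp (hnn : ∀ x ∈ M, 0 ≤ x) {m x y z : ℤ} (hx : x ∈ M) (hy : y ∈ M)
    (hz : z ∈ M) (hx0 : x ≠ 0) (hy0 : y ≠ 0) (h : x + y + z ∈ Ap M m) :
    x + y ∈ decomposableAp M m := by
  refine ⟨mem_Ap_of_add_mem_Ap (M.add_mem hx hy) hz h, ?_⟩
  rintro (h0 | h0)
  · have := hnn x hx
    have := hnn y hy
    omega
  · exact h0.2.2 ⟨x, hx, y, hy, hx0, hy0, rfl⟩

/-- If a single decomposable element of the Apéry set is not a sum of three nonzero elements, then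
all the others are multiples of one minimal generator. -/
theorem exists_eq_mul_of_mem_decomposableAp (hnn : ∀ x ∈ M, 0 ≤ x) {m w₀ : ℤ}
    (hw₀ : w₀ ∈ decomposableAp M m)
    (hP : ∀ w ∈ decomposableAp M m, w ≠ w₀ →
      ∃ x ∈ M, ∃ y ∈ M, ∃ z ∈ M, x ≠ 0 ∧ y ≠ 0 ∧ z ≠ 0 ∧ w = x + y + z)
    (hle : ∀ w ∈ decomposableAp M m, w₀ ≤ w) (N : ℕ) :
    ∀ w ∈ decomposableAp M m, w ≠ w₀ → w ≤ N →
      ∃ g ∈ MinGens M ∩ Ap M m, w₀ = 2 * g ∧ ∃ q : ℕ, 3 ≤ q ∧ w = q * g := by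
  have hw₀0 : 0 < w₀ := lt_of_le_of_ne (hnn _ hw₀.1.1) (fun h => hw₀.2 (Or.inl h.symm))
  induction N with
  | zero =>
    intro w hw _ hN
    have := hle w hw
    push_cast at hN
    omega
  | succ N ih =>
    intro w hw hne hN
    obtain ⟨x, hx, y, hy, z, hz, hx0, hy0, hz0, rfl⟩ := hP w hw hne
    have px := lt_of_le_of_ne (hnn x hx) hx0.symm
    have py := lt_of_le_of_ne (hnn y hy) hy0.symm
    have pz := lt_of_le_of_ne (hnn z hz) hz0.symm
    push_cast at hN
    have main : ∀ x ∈ M, ∀ y ∈ M, ∀ z ∈ M, 0 < x → 0 < y → 0 < z → x + y + z ∈ Ap M m →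
        x + y + z ≤ N + 1 → x + y ≠ w₀ → ∃ g ∈ MinGens M ∩ Ap M m, w₀ = 2 * g ∧
          ∃ q : ℕ, 3 ≤ q ∧ x + y + z = q * g := by
      intro x hx y hy z hz px py pz hA hN hne
      obtain ⟨g, hg, hg2, q, hq, hqg⟩ := ih (x + y)
        (add_mem_decomposableAp hnn hx hy hz px.ne' py.ne' hA) hne (by omega)
      have hgz : g + z ∈ decomposableAp M m := by
        refine add_mem_decomposableAp hnn hg.1.1 hz (M.nsmul_mem hg.1.1 (q - 1)) hg.1.2.1 pz.ne' ?_
        convert hA using 1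
        rw [hqg, nsmul_eq_mul, Nat.cast_sub (by omega)]
        push_cast
        ring
      have hq' : (3 : ℤ) ≤ q := by exact_mod_cast hq
      by_cases hgz' : g + z = w₀
      · refine ⟨g, hg, hg2, q + 1, by omega, ?_⟩
        push_cast
        linarith
      · obtain ⟨g', -, hg2', q', hq3, hqg'⟩ := ih (g + z) hgz hgz' (by nlinarith)
        obtain rfl : g' = g := by omega
        refine ⟨g', hg, hg2, q + q' - 1, by omega, ?_⟩
        rw [Nat.cast_sub (by omega)]
        push_cast
        linarith
    by_cases h1 : x + y = w₀
    · by_cases h2 : y + z = w₀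
      · by_cases h3 : z + x = w₀
        · obtain rfl : y = x := by omega
          obtain rfl : z = y := by omega
          have hA : z ∈ Ap M m := mem_Ap_of_add_mem_Ap hx (M.add_mem hx hx)
            (by rw [← add_assoc]; exact hw.1)
          refine ⟨z, ⟨?_, hA⟩, by omega, 3, le_rfl, by push_cast; ring⟩
          by_contra hg
          have := hle z ⟨hA, by simp [hx0, hg]⟩
          omega
        · have := main z hz x hx y hy pz px py (by convert hw.1 using 1; ring) (by omega) h3
          convert this using 6
          ring_nf
      · have := main y hy z hz x hx py pz px (by convert hw.1 using 1; ring) (by omega) h2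
        convert this using 6
        ring_nf
    · exact main x hx y hy z hz px py pz hw.1 hN h1

/-- If all decomposable elements of the Apéry set but one are sums of three nonzero elements, then
they are consecutive multiples of a minimal generator. -/
theorem exists_decomposableAp_eq (hnn : ∀ x ∈ M, 0 ≤ x) {m : ℤ}
    (hP : ∀ w ∈ decomposableAp M m, ∀ w' ∈ decomposableAp M m,
      (¬ ∃ x ∈ M, ∃ y ∈ M, ∃ z ∈ M, x ≠ 0 ∧ y ≠ 0 ∧ z ≠ 0 ∧ w = x + y + z) →
      (¬ ∃ x ∈ M, ∃ y ∈ M, ∃ z ∈ M, x ≠ 0 ∧ y ≠ 0 ∧ z ≠ 0 ∧ w' = x + y + z) → w = w')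
    {ℓ : ℕ} (hℓ : 3 ≤ ℓ) (hcard : (decomposableAp M m).ncard = ℓ - 1) :
    ∃ g ∈ MinGens M ∩ Ap M m,
      decomposableAp M m = {x | ∃ q : ℕ, 2 ≤ q ∧ q ≤ ℓ ∧ x = q * g} := by
  have hDfin : (decomposableAp M m).Finite := Set.finite_of_ncard_pos (by omega)
  obtain ⟨w₀, hw₀, hle⟩ := Set.exists_min_image (decomposableAp M m) id hDfin
    (Set.nonempty_of_ncard_ne_zero (by omega))
  simp only [id] at hle
  have hw₀' : ¬ ∃ x ∈ M, ∃ y ∈ M, ∃ z ∈ M, x ≠ 0 ∧ y ≠ 0 ∧ z ≠ 0 ∧ w₀ = x + y + z := by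
    rintro ⟨x, hx, y, hy, z, hz, hx0, hy0, hz0, h⟩
    have := hle _ (add_mem_decomposableAp hnn hx hy hz hx0 hy0 (h ▸ hw₀.1))
    have := hnn z hz
    omega
  have hmul := fun w hw hne => exists_eq_mul_of_mem_decomposableAp hnn hw₀
    (fun w hw hne => by
      by_contra h
      exact hne (hP w hw w₀ hw₀ h hw₀')) hle w.toNat w hw hne (by omega)
  obtain ⟨w₁, hw₁, hne₁⟩ := Set.exists_ne_of_one_lt_ncard (s := decomposableAp M m) (by omega) w₀
  obtain ⟨g, hg, hg2, -⟩ := hmul w₁ hw₁ hne₁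
  have hg0 : g ≠ 0 := hg.1.2.1
  refine ⟨g, hg, ?_⟩
  have hD : decomposableAp M m =
      (fun q : ℕ => (q : ℤ) * g) '' {q : ℕ | 2 ≤ q ∧ (q : ℤ) * g ∈ decomposableAp M m} := by
    ext w
    constructor
    · intro hw
      by_cases hne : w = w₀
      · have h : ((2 : ℕ) : ℤ) * g = w := by
          push_cast
          omega
        exact ⟨2, ⟨le_rfl, h.symm ▸ hw⟩, h⟩
      · obtain ⟨g', -, hg2', q, hq, h⟩ := hmul w hw hne
        obtain rfl : g' = g := by omega
        exact ⟨q, ⟨by omega, h ▸ hw⟩, h.symm⟩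
    · rintro ⟨q, hq, rfl⟩
      exact hq.2
  set Q := {q : ℕ | 2 ≤ q ∧ (q : ℤ) * g ∈ decomposableAp M m} with hQ
  have hQcard : Q.ncard = ℓ - 1 := by
    rw [← hcard, hD, Set.ncard_image_of_injective]
    intro p q hpq
    simpa [hg0] using hpq
  have hQfin : Q.Finite := Set.finite_of_ncard_pos (by omega)
  have hicc : ∀ p q : ℕ, (Set.Icc p q).ncard = q + 1 - p := fun p q => by
    rw [← Finset.coe_Icc, Set.ncard_coe_finset, Nat.card_Icc]
  have hsub : Q ⊆ Set.Icc 2 ℓ := by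
    intro q hq
    refine ⟨hq.1, ?_⟩
    have : Set.Icc 2 q ⊆ Q := by
      rintro p ⟨hp2, hpq⟩
      refine ⟨hp2, ?_⟩
      have := add_mem_decomposableAp hnn hg.1.1 (M.nsmul_mem hg.1.1 (p - 1))
        (M.nsmul_mem hg.1.1 (q - p)) (m := m) hg0 ?_ ?_
      · convert this using 1
        rw [nsmul_eq_mul, Nat.cast_sub (by omega)]
        push_cast
        ring
      · simp only [nsmul_eq_mul, ne_eq, mul_eq_zero, hg0, or_false, Nat.cast_eq_zero]
        omega
      · convert hq.2.1 using 1
        rw [nsmul_eq_mul, nsmul_eq_mul, Nat.cast_sub (by omega), Nat.cast_sub (by omega)]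
        push_cast
        ring
    have := Set.ncard_le_ncard this hQfin
    rw [hicc] at this
    omega
  have hQeq : Q = Set.Icc 2 ℓ :=
    Set.eq_of_subset_of_ncard_le hsub (by rw [hicc]; omega) (Set.finite_Icc _ _)
  rw [hD, hQeq]
  ext w
  simp only [Set.mem_image, Set.mem_Icc, Set.mem_ofPred_eq, and_assoc, eq_comm]

end Apery

theorem stmt8 (k : Type*) [Field k] (n : ℕ) [NeZero n] (a : Fin n → ℕ)
    (hpos : ∀ i, 0 < a i) (hinj : Function.Injective a)
    (hmult : ∀ i : Fin n, i ≠ 0 → a 0 < a i)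
    (H : Set ℤ)
    (hH : H = (AddSubmonoid.closure (Set.range fun i => ((a i : ℤ))) : AddSubmonoid ℤ))
    (hfin : {z : ℤ | 0 ≤ z ∧ z ∉ H}.Finite)
    (hmin : MinGens H = Set.range fun i => ((a i : ℤ)))
    (ℓ : ℕ) (hℓ : (ℓ : ℤ) = (a 0 : ℤ) - n + 1) :
    Stretched ((NSRing k a) ⧸ (Ideal.span {tMult k a})) ↔
      ((ℓ = 1 → Ap H (a 0) =
          insert (0 : ℤ) {x : ℤ | ∃ i : Fin n, i ≠ 0 ∧ x = (a i : ℤ)}) ∧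
       (ℓ = 2 → ∃ lam mu : Fin n, lam ≠ 0 ∧ mu ≠ 0 ∧ lam ≤ mu ∧
          Ap H (a 0) = insert (0 : ℤ) {x : ℤ | ∃ i : Fin n, i ≠ 0 ∧ x = (a i : ℤ)} ∪
            {(a lam : ℤ) + (a mu : ℤ)}) ∧
       (3 ≤ ℓ → ∃ lam : Fin n, lam ≠ 0 ∧
          Ap H (a 0) = insert (0 : ℤ) {x : ℤ | ∃ i : Fin n, i ≠ 0 ∧ x = (a i : ℤ)} ∪
            {x : ℤ | ∃ q : ℕ, 2 ≤ q ∧ q ≤ ℓ ∧ x = (q : ℤ) * (a lam : ℤ)})) := by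
  subst hH
  set M := AddSubmonoid.closure (Set.range fun i => ((a i : ℤ))) with hM
  have hnn : ∀ x ∈ M, 0 ≤ x := fun x hx => nonneg_of_mem_closure hx
  have haM : ∀ i, (a i : ℤ) ∈ M := fun i => AddSubmonoid.subset_closure ⟨i, rfl⟩
  have hgen : ∀ i, (a i : ℤ) ∈ MinGens M := fun i => hmin ▸ ⟨i, rfl⟩
  have hgt : ∀ i : Fin n, i ≠ 0 → (a 0 : ℤ) < a i := fun i hi => by exact_mod_cast hmult i hi
  have ha0 : ∀ i, (a i : ℤ) ≠ 0 := fun i => by exact_mod_cast (hpos i).ne'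
  have hexists : ∀ z ∈ M, ∃ s ∈ AddSubmonoid.closure (Set.range a), (s : ℤ) = z := by
    intro z hz
    lift z to ℕ using hnn z hz
    exact ⟨z, natCast_mem_closure_iff.mp hz, rfl⟩
  have hadd : ∀ i j, (a i : ℤ) + a j ∉ MinGens M := fun i j h =>
    h.2.2 ⟨_, haM i, _, haM j, ha0 i, ha0 j, rfl⟩
  set B : Set ℤ := insert (0 : ℤ) {x : ℤ | ∃ i : Fin n, i ≠ 0 ∧ x = (a i : ℤ)} with hB
  have hBle : B ⊆ insert 0 (MinGens M) := by
    rintro _ (rfl | ⟨i, -, rfl⟩)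
    · exact Or.inl rfl
    · exact Or.inr (hgen i)
  have hnotAp : (a 0 : ℤ) ∉ Ap M (a 0) := fun h => h.2 (by simp)
  have hBAp : B ⊆ Ap M (a 0) := by
    rintro _ (rfl | ⟨i, hi, rfl⟩)
    · exact ⟨zero_mem M, fun h => by have := hnn _ h; have := hpos 0; omega⟩
    · refine ⟨haM i, fun h => (hgen i).2.2 ⟨_, haM 0, _, h, ha0 0, ?_, by ring⟩⟩
      have := hgt i hi
      omega
  have hD : decomposableAp M (a 0) = Ap M (a 0) \ B := by
    refine Set.Subset.antisymm (Set.sdiff_subset_sdiff_right hBle) fun x hx => ⟨hx.1, ?_⟩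
    rintro (h | h)
    · exact hx.2 (Or.inl h)
    · rw [hmin] at h
      obtain ⟨i, rfl⟩ := h
      refine hx.2 (Or.inr ⟨i, ?_, rfl⟩)
      rintro rfl
      exact hnotAp hx.1
  have hAp : Ap M (a 0) = B ∪ decomposableAp M (a 0) := by
    rw [hD, Set.union_sdiff_cancel hBAp]
  have hApcard := ncard_Ap hnn (hpos 0) (haM 0) hfin
  have hApfin : (Ap (M : Set ℤ) (a 0)).Finite :=
    Set.finite_of_ncard_pos (by rw [hApcard]; exact hpos 0)
  have hBcard : B.ncard = n := by
    have hBimg : B = (fun i : Fin n => if i = 0 then (0 : ℤ) else a i) '' Set.univ := by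
      ext x
      constructor
      · rintro (rfl | ⟨i, hi, rfl⟩)
        · exact ⟨0, trivial, if_pos rfl⟩
        · exact ⟨i, trivial, if_neg hi⟩
      · rintro ⟨i, -, rfl⟩
        by_cases hi : i = 0
        · exact Or.inl (if_pos hi)
        · exact Or.inr ⟨i, hi, if_neg hi⟩
    rw [hBimg, Set.ncard_image_of_injective, Set.ncard_univ, Nat.card_fin]
    intro i j hij
    by_cases hi : i = 0 <;> by_cases hj : j = 0
    · rw [hi, hj]
    · exact absurd hij.symm (by simpa [hi, hj] using ha0 j)
    · exact absurd hij (by simpa [hi, hj] using ha0 i)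
    · exact hinj (by simpa [hi, hj] using hij)
  have hDcard : (decomposableAp M (a 0)).ncard = ℓ - 1 ∧ 1 ≤ ℓ := by
    have h1 := Set.ncard_le_ncard hBAp hApfin
    have h2 := Set.ncard_sdiff_add_ncard_of_subset hBAp hApfin
    rw [← hD] at h2
    omega
  have hrep : ∀ w ∈ decomposableAp M (a 0), ∃ i j, ∃ s ∈ M, w = a i + a j + s := by
    intro w hw
    obtain ⟨x, hx, y, hy, hx0, hy0, rfl⟩ := exists_add_eq_of_mem_decomposableAp hw
    obtain ⟨_, ⟨i, rfl⟩, x', hx', rfl⟩ := AddSubmonoid.exists_eq_add_of_mem_closure hx hx0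
    obtain ⟨_, ⟨j, rfl⟩, y', hy', rfl⟩ := AddSubmonoid.exists_eq_add_of_mem_closure hy hy0
    exact ⟨i, j, x' + y', M.add_mem hx' hy', by ring⟩
  have hsurj := Ideal.Quotient.mk_surjective (I := Ideal.span {tMult k a})
  have hker : ∀ f, Ideal.Quotient.mk (Ideal.span {tMult k a}) f = 0 ↔ tMult k a ∣ f := fun f => by
    rw [Ideal.Quotient.eq_zero_iff_mem, Ideal.mem_span_singleton]
  constructor
  · intro hst
    refine ⟨fun h1 => ?_, fun h2 => ?_, fun h3 => ?_⟩
    · have hDfin : (decomposableAp (M : Set ℤ) (a 0)).Finite := hApfin.subset Set.sdiff_subset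
      rw [h1, Set.ncard_eq_zero hDfin] at hDcard
      rw [hAp, hDcard.1, Set.union_empty]
    · rw [h2] at hDcard
      obtain ⟨w, hw⟩ := Set.ncard_eq_one.mp hDcard.1
      have hwD : w ∈ decomposableAp M (a 0) := hw ▸ rfl
      obtain ⟨i, j, s, hs, rfl⟩ := hrep w hwD
      have hij : (a i : ℤ) + a j = a i + a j + s := by
        have := add_mem_decomposableAp hnn (haM i) (haM j) hs (ha0 i) (ha0 j) hwD.1
        rwa [hw] at this
      rw [← hij] at hw hwD
      have hi : i ≠ 0 := by
        rintro rfl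
        exact hnotAp (mem_Ap_of_add_mem_Ap (haM _) (haM j) hwD.1)
      have hj : j ≠ 0 := by
        rintro rfl
        exact hnotAp (mem_Ap_of_add_mem_Ap (haM _) (haM i) (add_comm (a i : ℤ) _ ▸ hwD.1))
      rw [hw] at hAp
      rcases le_total i j with hle | hle
      · exact ⟨i, j, hi, hj, hle, hAp⟩
      · exact ⟨j, i, hj, hi, hle, by rw [hAp, add_comm]⟩
    · have hP : ∀ w ∈ decomposableAp M (a 0),
          (¬ ∃ x ∈ M, ∃ y ∈ M, ∃ z ∈ M, x ≠ 0 ∧ y ≠ 0 ∧ z ≠ 0 ∧ w = x + y + z) →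
          ∃ i j, w = a i + a j ∧
            (∀ s ∈ AddSubmonoid.closure (Set.range a), a i + a j ≠ a 0 + s) ∧
            ∀ p q, ∀ s ∈ AddSubmonoid.closure (Set.range a), s ≠ 0 → a i + a j ≠ a p + a q + s := by
        intro w hw h
        obtain ⟨i, j, s, hs, rfl⟩ := hrep w hw
        obtain rfl : s = 0 := by
          by_contra hs0
          exact h ⟨_, haM i, _, haM j, s, hs, ha0 i, ha0 j, hs0, rfl⟩
        rw [add_zero] at hw h ⊢
        refine ⟨i, j, rfl, fun s hs hij => hw.1.2 ?_, fun p q s hs hs0 hij => h ?_⟩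
        · rw [show (a i : ℤ) + a j - a 0 = s by omega]
          exact natCast_mem_closure_iff.mpr hs
        · exact ⟨_, haM p, _, haM q, s, natCast_mem_closure_iff.mpr hs, ha0 p, ha0 q,
            by exact_mod_cast hs0, by exact_mod_cast hij⟩
      obtain ⟨g, ⟨hg, hgA⟩, hDeq⟩ := exists_decomposableAp_eq (m := a 0) hnn
        (fun w hw w' hw' ho ho' => by
          obtain ⟨i, j, rfl, hij, hoij⟩ := hP w hw ho
          obtain ⟨i', j', rfl, hij', hoij'⟩ := hP w' hw' ho'
          exact_mod_cast Stretched.eq_of_not_exists_add hpos hsurj hker hst hij hij' hoij hoij')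
        h3 hDcard.1
      rw [hmin] at hg
      obtain ⟨i, rfl⟩ := hg
      refine ⟨i, ?_, by rw [hAp, hDeq]⟩
      rintro rfl
      exact hnotAp hgA
  · rintro ⟨h1, h2, h3⟩
    suffices h : ∃ i₀ j₀ : Fin n, ∀ i j, (a i : ℤ) + a j ∈ decomposableAp M (a 0) →
        (a i : ℤ) + a j - (a i₀ + a j₀) ∈ M by
      obtain ⟨i₀, j₀, h⟩ := h
      refine stretched_of_forall_sub_mem hpos hsurj ((hker _).mpr dvd_rfl) i₀ j₀ fun i j => ?_
      by_cases hA : (a i : ℤ) + a j - a 0 ∈ M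
      · obtain ⟨s, hs, hsz⟩ := hexists _ hA
        exact Or.inl ⟨s, hs, by omega⟩
      · have hij : (a i : ℤ) + a j ∈ decomposableAp M (a 0) := by
          refine ⟨⟨M.add_mem (haM i) (haM j), hA⟩, ?_⟩
          rintro (h0 | h0)
          · have := hpos i
            omega
          · exact hadd i j h0
        obtain ⟨s, hs, hsz⟩ := hexists _ (h i j hij)
        exact Or.inr ⟨s, hs, by omega⟩
    rw [hD]
    obtain h | h | h : ℓ = 1 ∨ ℓ = 2 ∨ 3 ≤ ℓ := by omega
    · rw [h1 h, Set.sdiff_self]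
      exact ⟨0, 0, fun _ _ => False.elim⟩
    · obtain ⟨i₀, j₀, -, -, -, hA⟩ := h2 h
      refine ⟨i₀, j₀, fun i j hij => ?_⟩
      rw [hA, Set.union_sdiff_left] at hij
      rw [show (a i : ℤ) + a j = a i₀ + a j₀ from hij.1, sub_self]
      exact zero_mem M
    · obtain ⟨i₀, -, hA⟩ := h3 h
      refine ⟨i₀, i₀, fun i j hij => ?_⟩
      rw [hA, Set.union_sdiff_left] at hij
      obtain ⟨⟨q, hq, -, hij⟩, -⟩ := hij
      rw [hij]
      convert M.nsmul_mem (haM i₀) (q - 2) using 1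
      rw [nsmul_eq_mul, Nat.cast_sub hq]
      push_cast
      ring
end
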